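/- arXiv:1403.2146 — 5 statements merged into one kernel-verified Lean document; each statement's English description precedes it below -/
import Mathlib

section
/- Let U ⊆ ℂ² be open and let f = f₁ + f₂j and g = g₁ + g₂j be hyperholomorphic quaternionic functions on U whose components f₁, f₂, g₁, g₂ are all real-valued. Then the product f*g, whose components are (f₁g₁ − f₂g₂, f₁g₂ + f₂g₁), is hyperholomorphic on U. In particular the set of hyperholomorphic functions with real components is closed under the quaternionic product. -/
noncomputable section

open Complex

/-- Wirtinger derivative `∂f/∂z₁` of `f : ℂ × ℂ → ℂ` (as a real-differentiable map). -/
def dz1 (f : ℂ × ℂ → ℂ) (p : ℂ × ℂ) : ℂ :=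
  (1 / 2 : ℂ) * (fderiv ℝ f p (1, 0) - Complex.I * fderiv ℝ f p (Complex.I, 0))

/-- Wirtinger derivative `∂f/∂z̄₁`. -/
def dz1c (f : ℂ × ℂ → ℂ) (p : ℂ × ℂ) : ℂ :=
  (1 / 2 : ℂ) * (fderiv ℝ f p (1, 0) + Complex.I * fderiv ℝ f p (Complex.I, 0))

/-- Wirtinger derivative `∂f/∂z₂`. -/
def dz2 (f : ℂ × ℂ → ℂ) (p : ℂ × ℂ) : ℂ :=
  (1 / 2 : ℂ) * (fderiv ℝ f p (0, 1) - Complex.I * fderiv ℝ f p (0, Complex.I))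

/-- Wirtinger derivative `∂f/∂z̄₂`. -/
def dz2c (f : ℂ × ℂ → ℂ) (p : ℂ × ℂ) : ℂ :=
  (1 / 2 : ℂ) * (fderiv ℝ f p (0, 1) + Complex.I * fderiv ℝ f p (0, Complex.I))

/-- Pointwise complex conjugate of a function. -/
def conjF (f : ℂ × ℂ → ℂ) : ℂ × ℂ → ℂ := fun p => (starRingEnd ℂ) (f p)

/-- `f = f₁ + f₂·j` is hyperholomorphic on `U`:
`∂f₁/∂z̄₁ - ∂f̄₂/∂z₂ = 0` and `∂f₁/∂z̄₂ + ∂f̄₂/∂z₁ = 0` on `U`. -/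
def Hyperholo (f₁ f₂ : ℂ × ℂ → ℂ) (U : Set (ℂ × ℂ)) : Prop :=
  ∀ p ∈ U, dz1c f₁ p - dz2 (conjF f₂) p = 0 ∧ dz2c f₁ p + dz1 (conjF f₂) p = 0

/-- `N = |f₁|² + |f₂|²`, the squared quaternionic norm of `f = f₁ + f₂ j`. -/
def invN (f₁ f₂ : ℂ × ℂ → ℂ) (p : ℂ × ℂ) : ℝ :=
  Complex.normSq (f₁ p) + Complex.normSq (f₂ p)

/-- First component `f̄₁ / N` of the pointwise quaternionic (right) inverse of `f = f₁ + f₂ j`. -/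
def inv1 (f₁ f₂ : ℂ × ℂ → ℂ) (p : ℂ × ℂ) : ℂ :=
  (starRingEnd ℂ) (f₁ p) / (invN f₁ f₂ p : ℂ)

/-- Second component `-f₂ / N` of the pointwise quaternionic (right) inverse of `f = f₁ + f₂ j`. -/
def inv2 (f₁ f₂ : ℂ × ℂ → ℂ) (p : ℂ × ℂ) : ℂ :=
  - f₂ p / (invN f₁ f₂ p : ℂ)

/-- A derivative of a function that is real-valued near `p` is real. -/
lemma fderiv_im_eq_zero {U : Set (ℂ × ℂ)} (hU : IsOpen U) {f : ℂ × ℂ → ℂ}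
    (hd : ∀ p ∈ U, DifferentiableAt ℝ f p)
    (hr : ∀ p ∈ U, (f p).im = 0) {p : ℂ × ℂ} (hp : p ∈ U) (v : ℂ × ℂ) :
    (fderiv ℝ f p v).im = 0 := by
  have h1 : HasFDerivAt (fun q => (f q).im) (Complex.imCLM.comp (fderiv ℝ f p)) p :=
    Complex.imCLM.hasFDerivAt.comp p (hd p hp).hasFDerivAt
  have h2 : (fun q => (f q).im) =ᶠ[nhds p] fun _ => (0 : ℝ) := by
    filter_upwards [hU.mem_nhds hp] with q hq using hr q hq
  have h3 := h1.unique ((hasFDerivAt_const (0 : ℝ) p).congr_of_eventuallyEq h2)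
  have h4 := congrArg (fun L => L v) h3
  simpa using h4

lemma fderiv_conjF {U : Set (ℂ × ℂ)} (hU : IsOpen U) {f : ℂ × ℂ → ℂ}
    (hr : ∀ p ∈ U, (f p).im = 0) {p : ℂ × ℂ} (hp : p ∈ U) :
    fderiv ℝ (conjF f) p = fderiv ℝ f p := by
  apply Filter.EventuallyEq.fderiv_eq
  filter_upwards [hU.mem_nhds hp] with q hq
  exact Complex.conj_eq_iff_im.2 (hr q hq)

/-- The real form of the equations. -/
lemma real_equations {U : Set (ℂ × ℂ)} (hU : IsOpen U) {f₁ f₂ : ℂ × ℂ → ℂ}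
    (hd₁ : ∀ p ∈ U, DifferentiableAt ℝ f₁ p) (hd₂ : ∀ p ∈ U, DifferentiableAt ℝ f₂ p)
    (hr₁ : ∀ p ∈ U, (f₁ p).im = 0) (hr₂ : ∀ p ∈ U, (f₂ p).im = 0)
    (hf : Hyperholo f₁ f₂ U) {p : ℂ × ℂ} (hp : p ∈ U) :
    fderiv ℝ f₁ p (1, 0) = fderiv ℝ f₂ p (0, 1) ∧
    fderiv ℝ f₁ p (Complex.I, 0) = - fderiv ℝ f₂ p (0, Complex.I) ∧
    fderiv ℝ f₁ p (0, 1) = - fderiv ℝ f₂ p (1, 0) ∧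
    fderiv ℝ f₁ p (0, Complex.I) = fderiv ℝ f₂ p (Complex.I, 0) := by
  obtain ⟨h1, h2⟩ := hf p hp
  simp only [dz1c, dz2c, dz1, dz2, fderiv_conjF hU hr₂ hp] at h1 h2
  have a := fun v => fderiv_im_eq_zero hU hd₁ hr₁ hp v
  have b := fun v => fderiv_im_eq_zero hU hd₂ hr₂ hp v
  have h1r := congrArg Complex.re h1
  have h1i := congrArg Complex.im h1
  have h2r := congrArg Complex.re h2
  have h2i := congrArg Complex.im h2
  simp [a, b] at h1r h1i h2r h2i
  refine ⟨Complex.ext ?_ ?_, Complex.ext ?_ ?_, Complex.ext ?_ ?_, Complex.ext ?_ ?_⟩ <;>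
    (try simp only [Complex.neg_re, Complex.neg_im, a, b, neg_zero]) <;> linarith

/-- the quaternionic product of two hyperholomorphic functions with
real-valued components, with components `(f₁g₁ - f₂g₂, f₁g₂ + f₂g₁)`, is
hyperholomorphic on `U`. -/
theorem mul_hyperholo_of_realComponents
    (U : Set (ℂ × ℂ)) (hU : IsOpen U) (f₁ f₂ g₁ g₂ : ℂ × ℂ → ℂ)
    (hf₁ : ContDiffOn ℝ (⊤ : ℕ∞) f₁ U) (hf₂ : ContDiffOn ℝ (⊤ : ℕ∞) f₂ U)
    (hg₁ : ContDiffOn ℝ (⊤ : ℕ∞) g₁ U) (hg₂ : ContDiffOn ℝ (⊤ : ℕ∞) g₂ U)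
    (hf₁r : ∀ p ∈ U, (f₁ p).im = 0) (hf₂r : ∀ p ∈ U, (f₂ p).im = 0)
    (hg₁r : ∀ p ∈ U, (g₁ p).im = 0) (hg₂r : ∀ p ∈ U, (g₂ p).im = 0)
    (hf : Hyperholo f₁ f₂ U) (hg : Hyperholo g₁ g₂ U) :
    Hyperholo (fun p => f₁ p * g₁ p - f₂ p * g₂ p)
      (fun p => f₁ p * g₂ p + f₂ p * g₁ p) U := by
  have D : ∀ h : ℂ × ℂ → ℂ, ContDiffOn ℝ (⊤ : ℕ∞) h U → ∀ p ∈ U, DifferentiableAt ℝ h p :=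
    fun h hh p hp => (hh.contDiffAt (hU.mem_nhds hp)).differentiableAt (by simp)
  intro p hp
  obtain ⟨a1, a2, a3, a4⟩ := real_equations hU (D _ hf₁) (D _ hf₂) hf₁r hf₂r hf hp
  obtain ⟨b1, b2, b3, b4⟩ := real_equations hU (D _ hg₁) (D _ hg₂) hg₁r hg₂r hg hp
  have F1 := (D _ hf₁ p hp).hasFDerivAt
  have F2 := (D _ hf₂ p hp).hasFDerivAt
  have G1 := (D _ hg₁ p hp).hasFDerivAt
  have G2 := (D _ hg₂ p hp).hasFDerivAt
  have e1 : fderiv ℝ (fun p => f₁ p * g₁ p - f₂ p * g₂ p) p = _ :=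
    ((F1.mul G1).sub (F2.mul G2)).fderiv
  have e2 : fderiv ℝ (fun p => f₁ p * g₂ p + f₂ p * g₁ p) p = _ :=
    ((F1.mul G2).add (F2.mul G1)).fderiv
  have hr : ∀ p ∈ U, ((fun p => f₁ p * g₂ p + f₂ p * g₁ p) p).im = 0 := by
    intro q hq
    simp [hf₁r q hq, hf₂r q hq, hg₁r q hq, hg₂r q hq]
  simp only [dz1c, dz2c, dz1, dz2, fderiv_conjF hU hr hp, e1, e2]
  simp only [add_apply, sub_apply,
    smul_apply, smul_eq_mul, a1, a2, a3, a4, b1, b2, b3, b4]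
  constructor <;> ring
end
end

section
/- (Characterization of hyperholomorphic functions with hyperholomorphic inverse.) Let U ⊆ ℂ² be open and let f = f₁ + f₂j be hyperholomorphic on U with f₁ and f₂ nowhere vanishing on U. Then the pointwise quaternionic inverse f⁻¹ is hyperholomorphic on U if and only if f₁, f₂ satisfy on U the two nonlinear PDE: (f̄₁ − f₁)·∂f̄₁/∂z₁ − f̄₂·∂f₂/∂z₁ − f₂·∂f̄₁/∂z̄₂ = 0 and f̄₂·∂f₁/∂z₁ + (f̄₁ − f₁)·∂f̄₂/∂z₁ − f₂·∂f̄₂/∂z̄₂ = 0. -/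
noncomputable section

open Complex

lemma fderiv_conjF_apply {f : ℂ × ℂ → ℂ} {p : ℂ × ℂ} (hf : DifferentiableAt ℝ f p) (v : ℂ × ℂ) :
    fderiv ℝ (conjF f) p v = (starRingEnd ℂ) (fderiv ℝ f p v) := by
  have h : HasFDerivAt (conjF f) ((Complex.conjCLE : ℂ →L[ℝ] ℂ).comp (fderiv ℝ f p)) p :=
    (Complex.conjCLE : ℂ →L[ℝ] ℂ).hasFDerivAt.comp p hf.hasFDerivAt
  rw [h.fderiv]
  simp

lemma differentiableAt_conjF {f : ℂ × ℂ → ℂ} {p : ℂ × ℂ} (hf : DifferentiableAt ℝ f p) :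
    DifferentiableAt ℝ (conjF f) p :=
  ((Complex.conjCLE : ℂ →L[ℝ] ℂ).hasFDerivAt.comp p hf.hasFDerivAt).differentiableAt

/-- Quotient rule in a direction, with the denominator `N = f₁ f̄₁ + f₂ f̄₂`. -/
lemma fderiv_quot_apply {f₁ f₂ h : ℂ × ℂ → ℂ} {p : ℂ × ℂ}
    (h₁ : DifferentiableAt ℝ f₁ p) (h₂ : DifferentiableAt ℝ f₂ p) (hh : DifferentiableAt ℝ h p)
    (hN : f₁ p * conjF f₁ p + f₂ p * conjF f₂ p ≠ 0) (v : ℂ × ℂ) :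
    fderiv ℝ (fun q => h q / (f₁ q * conjF f₁ q + f₂ q * conjF f₂ q)) p v =
      (fderiv ℝ h p v * (f₁ p * conjF f₁ p + f₂ p * conjF f₂ p)
        - h p * (fderiv ℝ f₁ p v * conjF f₁ p + f₁ p * (starRingEnd ℂ) (fderiv ℝ f₁ p v)
          + fderiv ℝ f₂ p v * conjF f₂ p + f₂ p * (starRingEnd ℂ) (fderiv ℝ f₂ p v)))
      / (f₁ p * conjF f₁ p + f₂ p * conjF f₂ p) ^ 2 := by
  have c₁ := differentiableAt_conjF h₁
  have c₂ := differentiableAt_conjF h₂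
  have hD := (h₁.hasFDerivAt.mul c₁.hasFDerivAt).add (h₂.hasFDerivAt.mul c₂.hasFDerivAt)
  have hq : DifferentiableAt ℝ
      (fun q => h q / (f₁ q * conjF f₁ q + f₂ q * conjF f₂ q)) p := by
    have := hh.mul (hD.differentiableAt.inv hN)
    simp only [div_eq_mul_inv]
    exact this
  have hprod := hq.hasFDerivAt.mul hD
  have hev : (fun q => h q) =ᶠ[nhds p] ((fun q => h q / (f₁ q * conjF f₁ q + f₂ q * conjF f₂ q)) *
      (f₁ * conjF f₁ + f₂ * conjF f₂)) := by
    filter_upwards [hD.differentiableAt.continuousAt.eventually_ne hN] with q hq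
    have hq' : f₁ q * conjF f₁ q + f₂ q * conjF f₂ q ≠ 0 := hq
    simp only [Pi.mul_apply, Pi.add_apply]
    field_simp
  have e := congrArg (fun L : ℂ × ℂ →L[ℝ] ℂ => L v)
    ((hprod.congr_of_eventuallyEq hev).unique hh.hasFDerivAt)
  simp only [ContinuousLinearMap.add_apply, ContinuousLinearMap.smul_apply, smul_eq_mul,
    Pi.mul_apply, Pi.add_apply, fderiv_conjF_apply h₁, fderiv_conjF_apply h₂] at e
  rw [← e]
  field_simp
  ring

/-- for `f = f₁ + f₂j` hyperholomorphic on `U` with `f₁, f₂` nowhere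
vanishing, the pointwise quaternionic inverse `f⁻¹` is hyperholomorphic on `U` iff
`(f̄₁ - f₁)∂f̄₁/∂z₁ - f̄₂ ∂f₂/∂z₁ - f₂ ∂f̄₁/∂z̄₂ = 0` and
`f̄₂ ∂f₁/∂z₁ + (f̄₁ - f₁)∂f̄₂/∂z₁ - f₂ ∂f̄₂/∂z̄₂ = 0` on `U`. -/
theorem inverse_hyperholo_characterization
    (U : Set (ℂ × ℂ)) (hU : IsOpen U) (f₁ f₂ : ℂ × ℂ → ℂ)
    (hf₁ : ContDiffOn ℝ (⊤ : ℕ∞) f₁ U) (hf₂ : ContDiffOn ℝ (⊤ : ℕ∞) f₂ U)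
    (hf : Hyperholo f₁ f₂ U)
    (hne : ∀ p ∈ U, f₁ p ≠ 0 ∧ f₂ p ≠ 0) :
    Hyperholo (inv1 f₁ f₂) (inv2 f₁ f₂) U ↔
      ∀ p ∈ U,
        ((starRingEnd ℂ) (f₁ p) - f₁ p) * dz1 (conjF f₁) p
            - (starRingEnd ℂ) (f₂ p) * dz1 f₂ p
            - f₂ p * dz2c (conjF f₁) p = 0 ∧
        (starRingEnd ℂ) (f₂ p) * dz1 f₁ p
            + ((starRingEnd ℂ) (f₁ p) - f₁ p) * dz1 (conjF f₂) p
            - f₂ p * dz2c (conjF f₂) p = 0 := by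
  have key : ∀ p ∈ U,
      ((dz1c (inv1 f₁ f₂) p - dz2 (conjF (inv2 f₁ f₂)) p = 0 ∧
        dz2c (inv1 f₁ f₂) p + dz1 (conjF (inv2 f₁ f₂)) p = 0) ↔
        (((starRingEnd ℂ) (f₁ p) - f₁ p) * dz1 (conjF f₁) p
            - (starRingEnd ℂ) (f₂ p) * dz1 f₂ p
            - f₂ p * dz2c (conjF f₁) p = 0 ∧
        (starRingEnd ℂ) (f₂ p) * dz1 f₁ p
            + ((starRingEnd ℂ) (f₁ p) - f₁ p) * dz1 (conjF f₂) p
            - f₂ p * dz2c (conjF f₂) p = 0)) := by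
    intro p hp
    have d₁ : DifferentiableAt ℝ f₁ p :=
      (hf₁.contDiffAt (hU.mem_nhds hp)).differentiableAt (by simp)
    have d₂ : DifferentiableAt ℝ f₂ p :=
      (hf₂.contDiffAt (hU.mem_nhds hp)).differentiableAt (by simp)
    have hNe : ∀ q, (invN f₁ f₂ q : ℂ) = f₁ q * conjF f₁ q + f₂ q * conjF f₂ q := by
      intro q
      simp [invN, conjF, Complex.mul_conj]
    have hN : f₁ p * conjF f₁ p + f₂ p * conjF f₂ p ≠ 0 := by
      rw [← hNe]
      have h1 := Complex.normSq_pos.2 (hne p hp).1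
      have h2 := Complex.normSq_nonneg (f₂ p)
      have : invN f₁ f₂ p ≠ 0 := by unfold invN; positivity
      exact_mod_cast this
    have e1 : inv1 f₁ f₂ = fun q => conjF f₁ q / (f₁ q * conjF f₁ q + f₂ q * conjF f₂ q) := by
      funext q
      rw [← hNe]; rfl
    have e2 : conjF (inv2 f₁ f₂) =
        fun q => (fun r => - conjF f₂ r) q / (f₁ q * conjF f₁ q + f₂ q * conjF f₂ q) := by
      funext q
      simp only [← hNe]
      simp [conjF, inv2]
    have hneg : ∀ v, fderiv ℝ (fun r => - conjF f₂ r) p v = - (starRingEnd ℂ) (fderiv ℝ f₂ p v) := by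
      intro v
      rw [fderiv_fun_neg, _root_.neg_apply, fderiv_conjF_apply d₂]
    obtain ⟨H1, H2⟩ := hf p hp
    rw [e1, e2]
    simp only [dz1, dz1c, dz2, dz2c, fderiv_conjF_apply d₁, fderiv_conjF_apply d₂,
      fderiv_quot_apply d₁ d₂ (differentiableAt_conjF d₁) hN,
      fderiv_quot_apply d₁ d₂ (differentiableAt_conjF d₂).fun_neg hN, hneg] at H1 H2 ⊢
    have H1c := congrArg (starRingEnd ℂ) H1
    have H2c := congrArg (starRingEnd ℂ) H2
    simp only [conjF] at hN ⊢
    generalize fderiv ℝ f₁ p (1, 0) = u1 at *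
    generalize fderiv ℝ f₁ p (Complex.I, 0) = u2 at *
    generalize fderiv ℝ f₁ p (0, 1) = u3 at *
    generalize fderiv ℝ f₁ p (0, Complex.I) = u4 at *
    generalize fderiv ℝ f₂ p (1, 0) = v1 at *
    generalize fderiv ℝ f₂ p (Complex.I, 0) = v2 at *
    generalize fderiv ℝ f₂ p (0, 1) = v3 at *
    generalize fderiv ℝ f₂ p (0, Complex.I) = v4 at *
    generalize f₁ p = a at *
    generalize f₂ p = b at *
    simp only [map_sub, map_add, map_mul, map_zero, Complex.conj_conj, Complex.conj_I, map_div₀,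
      map_one, map_ofNat] at H1c H2c
    have hconj : ∀ x y : ℂ, a * x + b * y = 0 ↔
        (starRingEnd ℂ) a * (starRingEnd ℂ) x + (starRingEnd ℂ) b * (starRingEnd ℂ) y = 0 := by
      intro x y
      rw [← map_mul, ← map_mul, ← map_add, map_eq_zero]
    have fin : ∀ S T E F : ℂ,
        E * (a * (starRingEnd ℂ) a + b * (starRingEnd ℂ) b) ^ 2 =
          (starRingEnd ℂ) a * (starRingEnd ℂ) S + (starRingEnd ℂ) b * (starRingEnd ℂ) T →
        F * (a * (starRingEnd ℂ) a + b * (starRingEnd ℂ) b) ^ 2 =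
          - (starRingEnd ℂ) b * S + (starRingEnd ℂ) a * T →
        ((E = 0 ∧ F = 0) ↔ (S = 0 ∧ T = 0)) := by
      intro S T E F hE hF
      constructor
      · rintro ⟨rfl, rfl⟩
        have h1 := (hconj S T).2 (by rw [← hE]; ring)
        have h2 : - (starRingEnd ℂ) b * S + (starRingEnd ℂ) a * T = 0 := by rw [← hF]; ring
        constructor
        · apply (mul_eq_zero.1 _).resolve_left hN
          linear_combination (starRingEnd ℂ) a * h1 - b * h2
        · apply (mul_eq_zero.1 _).resolve_left hN
          linear_combination (starRingEnd ℂ) b * h1 + a * h2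
      · rintro ⟨rfl, rfl⟩
        have hN2 := pow_ne_zero 2 hN
        constructor
        · apply (mul_eq_zero.1 _).resolve_right hN2
          rw [hE]; simp
        · apply (mul_eq_zero.1 _).resolve_right hN2
          rw [hF]; simp
    apply fin
    · simp only [map_sub, map_add, map_mul, Complex.conj_conj, Complex.conj_I, map_div₀,
        map_one, map_ofNat]
      clear fin hconj
      generalize (starRingEnd ℂ) a = A at *
      generalize (starRingEnd ℂ) b = B at *
      field_simp
      linear_combination (-2 * a * A) * H1 - 2 * a * B * H2c
    · clear fin hconj
      generalize (starRingEnd ℂ) a = A at *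
      generalize (starRingEnd ℂ) b = B at *
      field_simp
      linear_combination (2 * A * B) * H1c - 2 * A ^ 2 * H2
  exact ⟨fun h p hp => (key p hp).1 (h p hp), fun h p hp => (key p hp).2 (h p hp)⟩
end
end

section
/- Let U ⊆ ℂ² be open and let f = f₁ + f₂j be a quaternionic function on U whose components f₁, f₂ are real-valued and such that f is nowhere vanishing on U. Then the following are equivalent: (i) f and its pointwise quaternionic inverse f⁻¹ are both hyperholomorphic on U; (ii) f₁, f₂ satisfy the linear system ∂f₂/∂z₁ + ∂f₁/∂z̄₂ = 0 and ∂f₁/∂z₁ − ∂f₂/∂z̄₂ = 0 on U. -/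
noncomputable section

open Complex

theorem fderiv_of_real_eventually {f : ℂ × ℂ → ℂ} {u : ℂ × ℂ → ℝ} {A : ℂ × ℂ →L[ℝ] ℝ} {p : ℂ × ℂ}
    (h : f =ᶠ[nhds p] fun q => ((u q : ℝ) : ℂ)) (hu : HasFDerivAt u A p) (w : ℂ × ℂ) :
    fderiv ℝ f p w = ((A w : ℝ) : ℂ) := by
  have h1 : HasFDerivAt (fun q => ((u q : ℝ) : ℂ)) (Complex.ofRealCLM.comp A) p :=
    Complex.ofRealCLM.hasFDerivAt.comp p hu
  rw [(h1.congr_of_eventuallyEq h).fderiv]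
  rfl

/-- for a nowhere vanishing quaternionic function with real-valued
components, `f` and `f⁻¹` are both hyperholomorphic on `U` iff
`∂f₂/∂z₁ + ∂f₁/∂z̄₂ = 0` and `∂f₁/∂z₁ - ∂f₂/∂z̄₂ = 0` on `U`. -/
theorem real_components_inverse_characterization
    (U : Set (ℂ × ℂ)) (hU : IsOpen U) (f₁ f₂ : ℂ × ℂ → ℂ)
    (hf₁ : ContDiffOn ℝ (⊤ : ℕ∞) f₁ U) (hf₂ : ContDiffOn ℝ (⊤ : ℕ∞) f₂ U)
    (hf₁r : ∀ p ∈ U, (f₁ p).im = 0) (hf₂r : ∀ p ∈ U, (f₂ p).im = 0)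
    (hne : ∀ p ∈ U, ¬ (f₁ p = 0 ∧ f₂ p = 0)) :
    (Hyperholo f₁ f₂ U ∧ Hyperholo (inv1 f₁ f₂) (inv2 f₁ f₂) U) ↔
      ∀ p ∈ U, dz1 f₂ p + dz2c f₁ p = 0 ∧ dz1 f₁ p - dz2c f₂ p = 0 := by
  have key : ∀ p ∈ U, ∃ (x y : ℝ) (A B : ℂ × ℂ →L[ℝ] ℝ),
      (∀ w, fderiv ℝ f₁ p w = ((A w : ℝ) : ℂ)) ∧ (∀ w, fderiv ℝ f₂ p w = ((B w : ℝ) : ℂ)) ∧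
      (∀ w, fderiv ℝ (conjF f₂) p w = ((B w : ℝ) : ℂ)) ∧
      (∀ w, fderiv ℝ (inv1 f₁ f₂) p w = (((y * A w - x * B w : ℝ)) : ℂ)) ∧
      (∀ w, fderiv ℝ (conjF (inv2 f₁ f₂)) p w = (((y * B w + x * A w : ℝ)) : ℂ)) := by
    intro p hp
    have hpU := hU.mem_nhds hp
    have d1 : DifferentiableAt ℝ f₁ p := (hf₁.contDiffAt hpU).differentiableAt (by simp)
    have d2 : DifferentiableAt ℝ f₂ p := (hf₂.contDiffAt hpU).differentiableAt (by simp)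
    set u : ℂ × ℂ → ℝ := fun q => (f₁ q).re with hu
    set v : ℂ × ℂ → ℝ := fun q => (f₂ q).re with hv
    have hA : HasFDerivAt u (Complex.reCLM.comp (fderiv ℝ f₁ p)) p :=
      Complex.reCLM.hasFDerivAt.comp p d1.hasFDerivAt
    have hB : HasFDerivAt v (Complex.reCLM.comp (fderiv ℝ f₂ p)) p :=
      Complex.reCLM.hasFDerivAt.comp p d2.hasFDerivAt
    generalize Complex.reCLM.comp (fderiv ℝ f₁ p) = A at hA
    generalize Complex.reCLM.comp (fderiv ℝ f₂ p) = B at hB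
    have e1 : ∀ q ∈ U, f₁ q = ((u q : ℝ) : ℂ) := fun q hq =>
      Complex.ext (by simp [hu]) (by simp [hf₁r q hq])
    have e2 : ∀ q ∈ U, f₂ q = ((v q : ℝ) : ℂ) := fun q hq =>
      Complex.ext (by simp [hv]) (by simp [hf₂r q hq])
    have hN : u p * u p + v p * v p ≠ 0 := by
      intro h
      apply hne p hp
      have h1 : u p = 0 := by nlinarith [mul_self_nonneg (u p), mul_self_nonneg (v p)]
      have h2 : v p = 0 := by nlinarith [mul_self_nonneg (u p), mul_self_nonneg (v p)]
      rw [e1 p hp, e2 p hp, h1, h2]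
      simp
    have hNd := (hA.mul hA).add (hB.mul hB)
    have hI := (hasDerivAt_inv hN).comp_hasFDerivAt p hNd
    have ha := hA.mul hI
    have hb := (hB.mul hI).neg
    refine ⟨2 * u p * v p / (u p * u p + v p * v p) ^ 2,
      (v p * v p - u p * u p) / (u p * u p + v p * v p) ^ 2, A, B, ?_, ?_, ?_, ?_, ?_⟩
    · exact fderiv_of_real_eventually (Filter.eventually_of_mem hpU e1) hA
    · exact fderiv_of_real_eventually (Filter.eventually_of_mem hpU e2) hB
    · refine fderiv_of_real_eventually (Filter.eventually_of_mem hpU fun q hq => ?_) hB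
      simp [conjF, e2 q hq]
    · intro w
      rw [fderiv_of_real_eventually (Filter.eventually_of_mem hpU fun q hq => ?_) ha]
      · congr 1
        simp
        field_simp
        ring
      · simp [inv1, invN, e1 q hq, e2 q hq, div_eq_mul_inv]
    · intro w
      rw [fderiv_of_real_eventually (Filter.eventually_of_mem hpU fun q hq => ?_) hb]
      · congr 1
        simp
        field_simp
        ring
      · simp [conjF, inv2, invN, e1 q hq, e2 q hq, div_eq_mul_inv]
  unfold Hyperholo
  rw [← forall₂_and]
  refine forall₂_congr fun p hp => ?_
  obtain ⟨x, y, A, B, h1, h2, h3, h4, h5⟩ := key p hp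
  simp only [dz1, dz2, dz1c, dz2c, h1, h2, h3, h4, h5]
  generalize A (1, 0) = a1
  generalize A (I, 0) = a2
  generalize A (0, 1) = a3
  generalize A (0, I) = a4
  generalize B (1, 0) = b1
  generalize B (I, 0) = b2
  generalize B (0, 1) = b3
  generalize B (0, I) = b4
  simp only [Complex.ext_iff]
  simp
  constructor
  · rintro ⟨⟨⟨h1, h2⟩, h3, h4⟩, -⟩
    refine ⟨⟨?_, ?_⟩, ?_, ?_⟩ <;> linarith
  · rintro ⟨⟨h1, h2⟩, h3, h4⟩
    have k1 : b1 = -a3 := by linarith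
    have k2 : b2 = a4 := by linarith
    have k3 : b3 = a1 := by linarith
    have k4 : b4 = -a2 := by linarith
    subst k1 k2 k3 k4
    refine ⟨⟨⟨?_, ?_⟩, ?_, ?_⟩, ⟨?_, ?_⟩, ?_, ?_⟩ <;> ring
end
end

section
/- Let U ⊆ ℂ² be open and let f = f₁ + f₂j be hyperholomorphic on U with both components f₁, f₂ real-valued. Then at every point p ∈ U with f(p) ≠ 0, the pointwise quaternionic inverse f⁻¹ is hyperholomorphic; i.e. for real-component quaternionic functions, hyperholomorphy of f implies hyperholomorphy of f⁻¹ wherever f⁻¹ is defined. -/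
noncomputable section

open Complex

theorem fderiv_ofReal_aux (F : ℂ × ℂ → ℂ) (g : ℂ × ℂ → ℝ) (a : ℂ × ℂ →L[ℝ] ℝ) (p : ℂ × ℂ)
    (h : F =ᶠ[nhds p] fun q => (g q : ℂ)) (hg : HasFDerivAt g a p) (w : ℂ × ℂ) :
    fderiv ℝ F p w = ((a w : ℝ) : ℂ) := by
  have h1 : HasFDerivAt (fun q => (g q : ℂ)) (Complex.ofRealCLM.comp a) p :=
    Complex.ofRealCLM.hasFDerivAt.comp p hg
  rw [h.fderiv_eq, h1.fderiv]
  rfl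

theorem hasFDerivAt_quot_aux (u v : ℂ × ℂ → ℝ) (a b : ℂ × ℂ →L[ℝ] ℝ) (p : ℂ × ℂ)
    (hu : HasFDerivAt u a p) (hv : HasFDerivAt v b p) (hN : u p * u p + v p * v p ≠ 0) :
    HasFDerivAt (fun q => u q * (u q * u q + v q * v q)⁻¹)
      ((((u p * u p + v p * v p) ^ 2)⁻¹) •
        ((v p * v p - u p * u p) • a - (2 * u p * v p) • b)) p := by
  have h := hu.mul ((hasDerivAt_inv hN).comp_hasFDerivAt p ((hu.mul hu).add (hv.mul hv)))
  refine h.congr_fderiv ?_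
  ext w <;> simp <;> field_simp <;> ring

/-- if `f = f₁ + f₂j` is hyperholomorphic on `U` with real-valued
components, then its pointwise quaternionic inverse is hyperholomorphic at every
point of `U` where `f` does not vanish. -/
theorem real_components_inverse_hyperholo
    (U : Set (ℂ × ℂ)) (hU : IsOpen U) (f₁ f₂ : ℂ × ℂ → ℂ)
    (hf₁ : ContDiffOn ℝ (⊤ : ℕ∞) f₁ U) (hf₂ : ContDiffOn ℝ (⊤ : ℕ∞) f₂ U)
    (hf₁r : ∀ p ∈ U, (f₁ p).im = 0) (hf₂r : ∀ p ∈ U, (f₂ p).im = 0)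
    (hf : Hyperholo f₁ f₂ U) :
    Hyperholo (inv1 f₁ f₂) (inv2 f₁ f₂)
      {p ∈ U | ¬ (f₁ p = 0 ∧ f₂ p = 0)} := by
  intro p hp
  obtain ⟨hpU, hp0⟩ := hp
  have hnb : U ∈ nhds p := hU.mem_nhds hpU
  have d1 : DifferentiableAt ℝ f₁ p := (hf₁.contDiffAt hnb).differentiableAt (by simp)
  have d2 : DifferentiableAt ℝ f₂ p := (hf₂.contDiffAt hnb).differentiableAt (by simp)
  obtain ⟨u, hu⟩ : ∃ u : ℂ × ℂ → ℝ, u = fun q => (f₁ q).re := ⟨_, rfl⟩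
  obtain ⟨v, hv⟩ : ∃ v : ℂ × ℂ → ℝ, v = fun q => (f₂ q).re := ⟨_, rfl⟩
  obtain ⟨a, ha⟩ : ∃ a, HasFDerivAt u a p :=
    ⟨_, by rw [hu]; exact Complex.reCLM.hasFDerivAt.comp p d1.hasFDerivAt⟩
  obtain ⟨b, hb⟩ : ∃ b, HasFDerivAt v b p :=
    ⟨_, by rw [hv]; exact Complex.reCLM.hasFDerivAt.comp p d2.hasFDerivAt⟩
  have e1 : ∀ q ∈ U, f₁ q = (u q : ℂ) := fun q hq => by
    apply Complex.ext <;> simp [hu, hf₁r q hq]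
  have e2 : ∀ q ∈ U, f₂ q = (v q : ℂ) := fun q hq => by
    apply Complex.ext <;> simp [hv, hf₂r q hq]
  have hN : u p * u p + v p * v p ≠ 0 := by
    intro h
    apply hp0
    have h1 : u p = 0 := by nlinarith [mul_self_nonneg (u p), mul_self_nonneg (v p)]
    have h2 : v p = 0 := by nlinarith [mul_self_nonneg (u p), mul_self_nonneg (v p)]
    rw [e1 p hpU, e2 p hpU, h1, h2]
    simp
  have F1 := fderiv_ofReal_aux f₁ u a p (Filter.eventuallyEq_of_mem hnb e1) ha
  have F2 := fderiv_ofReal_aux (conjF f₂) v b p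
    (Filter.eventuallyEq_of_mem hnb fun q hq => by simp [conjF, e2 q hq]) hb
  have G1 := fderiv_ofReal_aux (inv1 f₁ f₂) _ _ p
    (Filter.eventuallyEq_of_mem hnb fun q hq => by
      simp [inv1, invN, e1 q hq, e2 q hq, div_eq_mul_inv]) (hasFDerivAt_quot_aux u v a b p ha hb hN)
  have hN' : v p * v p + u p * u p ≠ 0 := by rwa [add_comm]
  have G2 := fderiv_ofReal_aux (conjF (inv2 f₁ f₂)) _ _ p
    (Filter.eventuallyEq_of_mem hnb fun q hq => by
      simp [conjF, inv2, invN, e1 q hq, e2 q hq, div_eq_mul_inv, add_comm])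
    (hasFDerivAt_quot_aux v u b a p hb ha hN').neg
  obtain ⟨H1, H2⟩ := hf p hpU
  simp only [dz1, dz2, dz1c, dz2c, F1, F2] at H1 H2
  simp only [dz1, dz2, dz1c, dz2c, G1, G2]
  have A1 := congrArg Complex.re H1
  have A2 := congrArg Complex.im H1
  have A3 := congrArg Complex.re H2
  have A4 := congrArg Complex.im H2
  simp at A1 A2 A3 A4
  have B1 : a (1, 0) = b (0, 1) := by linarith
  have B2 : a (Complex.I, 0) = -b (0, Complex.I) := by linarith
  have B3 : a (0, 1) = -b (1, 0) := by linarith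
  have B4 : a (0, Complex.I) = b (Complex.I, 0) := by linarith
  rw [add_comm (v p * v p) (u p * u p)]
  constructor <;>
  · simp [B1, B2, B3, B4]
    ring
end
end

section
/- Fix A, B ∈ ℝ and define on ℂ² the real-valued functions f₁(z₁,z₂) = z₁ + z̄₁ + z₂ + z̄₂ + A and f₂(z₁,z₂) = −z₁ − z̄₁ + z₂ + z̄₂ + B. Then the quaternionic function f = f₁ + f₂j is hyperholomorphic on ℂ², and its pointwise quaternionic inverse f⁻¹ is hyperholomorphic on the open set {p ∈ ℂ² : f(p) ≠ 0}. -/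
noncomputable section

open Complex

/-- The real-valued component `f₁ = z₁ + z̄₁ + z₂ + z̄₂ + A`. -/
def ex1 (A : ℝ) : ℂ × ℂ → ℂ :=
  fun p => p.1 + (starRingEnd ℂ) p.1 + p.2 + (starRingEnd ℂ) p.2 + (A : ℂ)

/-- The real-valued component `f₂ = -z₁ - z̄₁ + z₂ + z̄₂ + B`. -/
def ex2 (B : ℝ) : ℂ × ℂ → ℂ :=
  fun p => -p.1 - (starRingEnd ℂ) p.1 + p.2 + (starRingEnd ℂ) p.2 + (B : ℂ)

/-- The real derivative of `ex1`. -/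
def L1 : ℂ × ℂ →L[ℝ] ℂ :=
  Complex.ofRealCLM.comp ((2 : ℝ) • (Complex.reCLM.comp (ContinuousLinearMap.fst ℝ ℂ ℂ)) +
    (2 : ℝ) • (Complex.reCLM.comp (ContinuousLinearMap.snd ℝ ℂ ℂ)))

/-- The real derivative of `ex2`. -/
def L2 : ℂ × ℂ →L[ℝ] ℂ :=
  Complex.ofRealCLM.comp (-(2 : ℝ) • (Complex.reCLM.comp (ContinuousLinearMap.fst ℝ ℂ ℂ)) +
    (2 : ℝ) • (Complex.reCLM.comp (ContinuousLinearMap.snd ℝ ℂ ℂ)))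

lemma ex1_eq (A : ℝ) : ex1 A = fun p => L1 p + (A : ℂ) := by
  funext p
  apply Complex.ext <;> simp [ex1, L1] <;> ring

lemma ex2_eq (B : ℝ) : ex2 B = fun p => L2 p + (B : ℂ) := by
  funext p
  apply Complex.ext <;> simp [ex2, L2] <;> ring

lemma conj_ex1 (A : ℝ) (p : ℂ × ℂ) : (starRingEnd ℂ) (ex1 A p) = ex1 A p := by
  simp [ex1]; ring

lemma conj_ex2 (B : ℝ) (p : ℂ × ℂ) : (starRingEnd ℂ) (ex2 B p) = ex2 B p := by
  simp [ex2]; ring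

lemma hasFDerivAt_ex1 (A : ℝ) (p : ℂ × ℂ) : HasFDerivAt (ex1 A) L1 p := by
  rw [ex1_eq]
  exact L1.hasFDerivAt.add_const _

lemma hasFDerivAt_ex2 (B : ℝ) (p : ℂ × ℂ) : HasFDerivAt (ex2 B) L2 p := by
  rw [ex2_eq]
  exact L2.hasFDerivAt.add_const _

lemma invN_eq (A B : ℝ) (p : ℂ × ℂ) :
    (invN (ex1 A) (ex2 B) p : ℂ) = ex1 A p * ex1 A p + ex2 B p * ex2 B p := by
  simp only [invN, Complex.ofReal_add, Complex.normSq_eq_conj_mul_self, conj_ex1, conj_ex2]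

lemma inv1_eq (A B : ℝ) : inv1 (ex1 A) (ex2 B) =
    fun p => ex1 A p * (ex1 A p * ex1 A p + ex2 B p * ex2 B p)⁻¹ := by
  funext p
  simp only [inv1, invN_eq, conj_ex1, div_eq_mul_inv]

lemma conj_inv2_eq (A B : ℝ) : conjF (inv2 (ex1 A) (ex2 B)) =
    fun p => -ex2 B p * (ex1 A p * ex1 A p + ex2 B p * ex2 B p)⁻¹ := by
  funext p
  simp only [conjF, inv2, map_div₀, map_neg, conj_ex2, Complex.conj_ofReal]
  rw [invN_eq, div_eq_mul_inv]

lemma conj_ex2_eq (B : ℝ) : conjF (ex2 B) = ex2 B := funext (conj_ex2 B)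

lemma fderiv_quot (A B : ℝ) (p v : ℂ × ℂ) (f : ℂ × ℂ → ℂ) (L : ℂ × ℂ →L[ℝ] ℂ)
    (hf : HasFDerivAt f L p) (h : ex1 A p * ex1 A p + ex2 B p * ex2 B p ≠ 0) :
    fderiv ℝ (fun p => f p * (ex1 A p * ex1 A p + ex2 B p * ex2 B p)⁻¹) p v =
      (L v * (ex1 A p * ex1 A p + ex2 B p * ex2 B p)
        - f p * (2 * ex1 A p * L1 v + 2 * ex2 B p * L2 v)) /
        (ex1 A p * ex1 A p + ex2 B p * ex2 B p) ^ 2 := by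
  have h1 := hasFDerivAt_ex1 A p
  have h2 := hasFDerivAt_ex2 B p
  have hN := (h1.fun_mul h1).fun_add (h2.fun_mul h2)
  have hI := (hasDerivAt_inv h).comp_hasFDerivAt_of_eq p (hN) rfl
  have := hf.fun_mul hI
  simp only [Function.comp_def] at this
  rw [this.fderiv]
  simp
  field_simp
  ring

/-- the function `f = f₁ + f₂j` with
`f₁ = z₁ + z̄₁ + z₂ + z̄₂ + A`, `f₂ = -z₁ - z̄₁ + z₂ + z̄₂ + B` is hyperholomorphic
on `ℂ²`, and its pointwise quaternionic inverse is hyperholomorphic where `f ≠ 0`. -/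
theorem numerical_example_hypermeromorphic (A B : ℝ) :
    Hyperholo (ex1 A) (ex2 B) Set.univ ∧
    Hyperholo (inv1 (ex1 A) (ex2 B)) (inv2 (ex1 A) (ex2 B))
      {p : ℂ × ℂ | ¬ (ex1 A p = 0 ∧ ex2 B p = 0)} := by
  constructor
  · intro p _
    simp only [dz1, dz2, dz1c, dz2c, conj_ex2_eq, (hasFDerivAt_ex1 A p).fderiv,
      (hasFDerivAt_ex2 B p).fderiv]
    constructor <;> simp [L1, L2]
  · intro p hp
    have h : ex1 A p * ex1 A p + ex2 B p * ex2 B p ≠ 0 := by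
      rw [← invN_eq]
      intro h0
      apply hp
      have h0' : invN (ex1 A) (ex2 B) p = 0 := by exact_mod_cast h0
      have a := Complex.normSq_nonneg (ex1 A p)
      have b := Complex.normSq_nonneg (ex2 B p)
      unfold invN at h0'
      exact ⟨Complex.normSq_eq_zero.mp (by linarith), Complex.normSq_eq_zero.mp (by linarith)⟩
    have k1 := fun v => fderiv_quot A B p v _ _ (hasFDerivAt_ex1 A p) h
    have k2 := fun v => fderiv_quot A B p v _ _ (hasFDerivAt_ex2 B p).fun_neg h
    simp only [dz1, dz2, dz1c, dz2c, conj_inv2_eq, inv1_eq, k1, k2]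
    constructor <;> simp [L1, L2] <;> field_simp <;> ring
end
end
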